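/- Let S, W, Z be measurable spaces, and let S, W, Z also denote the coordinate projections from S × W × Z. Then the set of probability measures π on the product S × W × Z (with the product σ-algebra) under which the conditional independence S ⫫_Z W holds is closed under convergence in total variation: if π^k → π in total variation and S ⫫_Z W holds under every π^k, then S ⫫_Z W holds under π. -/

import Mathlib

open MeasureTheory ProbabilityTheory
open scoped ENNReal

/-- The indicator of the event `{S ∈ A}`, as a real-valued random variable. -/
noncomputable def evtInd {Ω α : Type*} (S : Ω → α) (A : Set α) : Ω → ℝ :=
  (S ⁻¹' A).indicator fun _ => (1 : ℝ)

/-- Conditional independence `S ⫫_Z W` of `S` and `W` given (the σ-algebra generated by) `Z`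
under `P`: for all measurable sets `A`, `B`,
`P[1_{S ∈ A} 1_{W ∈ B} | σ(Z)] = P[1_{S ∈ A} | σ(Z)] ⬝ P[1_{W ∈ B} | σ(Z)]` `P`-a.s. -/
def CondIndepRV {Ω α β γ : Type*} [MeasurableSpace Ω] [MeasurableSpace α]
    [MeasurableSpace β] [MeasurableSpace γ]
    (P : Measure Ω) (S : Ω → α) (W : Ω → β) (Z : Ω → γ) : Prop :=
  ∀ (A : Set α) (B : Set β), MeasurableSet A → MeasurableSet B →
    (P[evtInd S A * evtInd W B | MeasurableSpace.comap Z inferInstance])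
      =ᵐ[P]
    (P[evtInd S A | MeasurableSpace.comap Z inferInstance]) *
      (P[evtInd W B | MeasurableSpace.comap Z inferInstance])

/-- Total variation distance between two measures. -/
noncomputable def tvDist {X : Type*} [MeasurableSpace X] (μ ν : Measure X) : ℝ≥0∞ :=
  ⨆ (A : Set X) (_ : MeasurableSet A), max (μ A - ν A) (ν A - μ A)

lemma tvDist_comm {X : Type*} [MeasurableSpace X] (μ ν : Measure X) :
    tvDist μ ν = tvDist ν μ := by
  simp only [tvDist, max_comm]

lemma measure_le_add_tvDist {X : Type*} [MeasurableSpace X] (μ ν : Measure X) {A : Set X}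
    (hA : MeasurableSet A) : μ A ≤ ν A + tvDist μ ν := by
  have h : max (μ A - ν A) (ν A - μ A) ≤ tvDist μ ν :=
    le_iSup₂ (f := fun (A : Set X) (_ : MeasurableSet A) => max (μ A - ν A) (ν A - μ A)) A hA
  exact tsub_le_iff_left.1 ((le_max_left _ _).trans h)

lemma tvDist_ne_top {X : Type*} [MeasurableSpace X] (μ ν : Measure X)
    [IsFiniteMeasure μ] [IsFiniteMeasure ν] : tvDist μ ν ≠ ∞ := by
  refine ne_top_of_le_ne_top (b := max (μ Set.univ) (ν Set.univ)) (by simp) ?_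
  exact iSup₂_le fun A _ => max_le_max (tsub_le_self.trans (measure_mono (Set.subset_univ A)))
    (tsub_le_self.trans (measure_mono (Set.subset_univ A)))

lemma lintegral_ofReal_le_add_tvDist {X : Type*} [MeasurableSpace X] (μ ν : Measure X)
    {u : X → ℝ} (hu : Measurable u) (h0 : ∀ x, 0 ≤ u x) (h1 : ∀ x, u x ≤ 1) :
    ∫⁻ x, ENNReal.ofReal (u x) ∂μ ≤ ∫⁻ x, ENNReal.ofReal (u x) ∂ν + tvDist μ ν := by
  rw [lintegral_eq_lintegral_meas_lt μ (.of_forall h0) hu.aemeasurable,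
    lintegral_eq_lintegral_meas_lt ν (.of_forall h0) hu.aemeasurable]
  have hle : ∀ t : ℝ, μ {a | t < u a} ≤
      ν {a | t < u a} + (Set.Iio (1 : ℝ)).indicator (fun _ => tvDist μ ν) t := by
    intro t
    by_cases ht : t < 1
    · rw [Set.indicator_of_mem (by exact ht)]
      exact measure_le_add_tvDist μ ν (measurableSet_lt measurable_const hu)
    · have : {a | t < u a} = ∅ := by
        ext a
        simpa using (h1 a).trans (not_lt.1 ht)
      simp [this]
  calc _ ≤ ∫⁻ t in Set.Ioi (0 : ℝ), (ν {a | t < u a} +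
        (Set.Iio (1 : ℝ)).indicator (fun _ => tvDist μ ν) t) := lintegral_mono hle
    _ = _ := by
      rw [lintegral_add_right _ (measurable_const.indicator measurableSet_Iio),
        lintegral_indicator measurableSet_Iio, Measure.restrict_restrict measurableSet_Iio,
        Set.Iio_inter_Ioi, setLIntegral_const]
      simp

lemma integrable_of_abs_le_one {X : Type*} [MeasurableSpace X] (μ : Measure X)
    [IsFiniteMeasure μ] {u : X → ℝ} (hu : Measurable u) (h1 : ∀ x, |u x| ≤ 1) :
    Integrable u μ :=
  .of_bound hu.aestronglyMeasurable 1 (.of_forall h1)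

lemma integral_le_add_tvDist {X : Type*} [MeasurableSpace X] (μ ν : Measure X)
    [IsProbabilityMeasure μ] [IsProbabilityMeasure ν]
    {u : X → ℝ} (hu : Measurable u) (h1 : ∀ x, |u x| ≤ 1) :
    ∫ x, u x ∂μ ≤ ∫ x, u x ∂ν + 2 * (tvDist μ ν).toReal := by
  have hv : Measurable fun x => (u x + 1) / 2 := by fun_prop
  have hv0 : ∀ x, 0 ≤ (u x + 1) / 2 := fun x => by linarith [(abs_le.1 (h1 x)).1]
  have hv1 : ∀ x, (u x + 1) / 2 ≤ 1 := fun x => by linarith [(abs_le.1 (h1 x)).2]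
  have hint (ρ : Measure X) [IsProbabilityMeasure ρ] :
      ∫ x, (u x + 1) / 2 ∂ρ = (∫ x, u x ∂ρ + 1) / 2 := by
    rw [integral_div, integral_add (integrable_of_abs_le_one ρ hu h1) (integrable_const _)]
    simp
  have hfin : ∫⁻ x, ENNReal.ofReal ((u x + 1) / 2) ∂ν ≠ ∞ :=
    (integrable_of_abs_le_one ν hv
      fun x => abs_le.2 ⟨by linarith [hv0 x], hv1 x⟩).lintegral_lt_top.ne
  have h := ENNReal.toReal_mono (ENNReal.add_ne_top.2 ⟨hfin, tvDist_ne_top μ ν⟩)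
    (lintegral_ofReal_le_add_tvDist μ ν hv hv0 hv1)
  rw [ENNReal.toReal_add hfin (tvDist_ne_top μ ν),
    ← integral_eq_lintegral_of_nonneg_ae (.of_forall hv0) hv.aestronglyMeasurable,
    ← integral_eq_lintegral_of_nonneg_ae (.of_forall hv0) hv.aestronglyMeasurable,
    hint, hint] at h
  linarith

/-- `f` is a version of `P[X | m]` with values in `[0, 1]`. -/
structure IsUnitCondExp {Ω : Type*} (m : MeasurableSpace Ω) {m0 : MeasurableSpace Ω}
    (P : Measure Ω) (X f : Ω → ℝ) : Prop where
  measurable : Measurable[m] f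
  mem_Icc : ∀ x, f x ∈ Set.Icc (0 : ℝ) 1
  ae_eq : f =ᵐ[P] P[X | m]

lemma exists_isUnitCondExp {Ω : Type*} {m m0 : MeasurableSpace Ω} (hm : m ≤ m0)
    (P : Measure Ω) [IsProbabilityMeasure P] {X : Ω → ℝ} (hX : Measurable X)
    (hX01 : ∀ x, X x ∈ Set.Icc (0 : ℝ) 1) : ∃ f, IsUnitCondExp m P X f := by
  have hXint : Integrable X P := integrable_of_abs_le_one P hX
    fun x => abs_le.2 ⟨by linarith [(hX01 x).1], (hX01 x).2⟩
  refine ⟨fun x => max 0 (min 1 ((P[X | m]) x)), ?_, fun x => ⟨le_max_left _ _, by simp⟩, ?_⟩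
  · exact measurable_const.max (measurable_const.min stronglyMeasurable_condExp.measurable)
  · have h0 : 0 ≤ᵐ[P] P[X | m] := condExp_nonneg (.of_forall fun x => (hX01 x).1)
    have h1 : P[X | m] ≤ᵐ[P] P[fun _ => (1 : ℝ) | m] :=
      condExp_mono hXint (integrable_const _) (.of_forall fun x => (hX01 x).2)
    rw [condExp_const hm] at h1
    filter_upwards [h0, h1] with x hx0 hx1
    exact (congrArg _ (min_eq_right hx1)).trans (max_eq_right hx0)

lemma IsUnitCondExp.integral_mul {Ω : Type*} {m m0 : MeasurableSpace Ω} (hm : m ≤ m0)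
    {P : Measure Ω} [IsProbabilityMeasure P] {X f d : Ω → ℝ} (hf : IsUnitCondExp m P X f)
    (hX : Measurable X) (hX01 : ∀ x, X x ∈ Set.Icc (0 : ℝ) 1)
    (hd : Measurable[m] d) (hd1 : ∀ x, |d x| ≤ 1) :
    ∫ x, d x * f x ∂P = ∫ x, d x * X x ∂P := by
  have hX1 : ∀ x, |X x| ≤ 1 := fun x => abs_le.2 ⟨by linarith [(hX01 x).1], (hX01 x).2⟩
  have hdX : Integrable (d * X) P := integrable_of_abs_le_one P ((hd.mono hm le_rfl).mul hX)
    fun x => by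
      rw [Pi.mul_apply, abs_mul]
      exact mul_le_one₀ (hd1 x) (abs_nonneg _) (hX1 x)
  have h := condExp_mul_of_stronglyMeasurable_left hd.stronglyMeasurable hdX
    (integrable_of_abs_le_one P hX hX1)
  calc ∫ x, d x * f x ∂P = ∫ x, (P[d * X | m]) x ∂P := integral_congr_ae (by
        filter_upwards [h, hf.ae_eq] with x hx hfx
        rw [hx, Pi.mul_apply, hfx])
    _ = _ := integral_condExp hm

/-- Bounded conditional expectations are stable in `L²` under total variation perturbations of
the measure. -/
lemma IsUnitCondExp.integral_sq_sub_le {Ω : Type*} {m m0 : MeasurableSpace Ω} (hm : m ≤ m0)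
    {μ ν : Measure Ω} [IsProbabilityMeasure μ] [IsProbabilityMeasure ν] {X f g : Ω → ℝ}
    (hf : IsUnitCondExp m μ X f) (hg : IsUnitCondExp m ν X g)
    (hX : Measurable X) (hX01 : ∀ x, X x ∈ Set.Icc (0 : ℝ) 1) :
    ∫ x, (f x - g x) ^ 2 ∂ν ≤ 4 * (tvDist μ ν).toReal := by
  have hd : Measurable[m] fun x => f x - g x := hf.measurable.sub hg.measurable
  have hd0 := hd.mono hm le_rfl
  have hf0 := hf.measurable.mono hm le_rfl
  have hg0 := hg.measurable.mono hm le_rfl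
  have hd1 : ∀ x, |f x - g x| ≤ 1 := fun x => by
    have h1 := hf.mem_Icc x
    have h2 := hg.mem_Icc x
    exact abs_le.2 ⟨by linarith [h1.1, h2.2], by linarith [h1.2, h2.1]⟩
  have hmeas : ∀ {Y : Ω → ℝ}, Measurable Y → Measurable fun x => (f x - g x) * Y x :=
    fun hY => hd0.mul hY
  have hbd : ∀ {Y : Ω → ℝ}, (∀ x, Y x ∈ Set.Icc (0 : ℝ) 1) → ∀ x, |(f x - g x) * Y x| ≤ 1 :=
    fun hY x => by
      rw [abs_mul]
      exact mul_le_one₀ (hd1 x) (abs_nonneg _)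
        (abs_le.2 ⟨by linarith [(hY x).1], (hY x).2⟩)
  have hsplit : ∫ x, (f x - g x) ^ 2 ∂ν =
      ∫ x, (f x - g x) * f x ∂ν - ∫ x, (f x - g x) * g x ∂ν := by
    rw [← integral_sub (integrable_of_abs_le_one ν (hmeas hf0) (hbd hf.mem_Icc))
      (integrable_of_abs_le_one ν (hmeas hg0) (hbd hg.mem_Icc))]
    congr with x
    ring
  have e1 := hf.integral_mul hm hX hX01 hd hd1
  have e2 := hg.integral_mul hm hX hX01 hd hd1
  have i1 := integral_le_add_tvDist ν μ (hmeas hf0) (hbd hf.mem_Icc)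
  have i2 := integral_le_add_tvDist μ ν (hmeas hX) (hbd hX01)
  rw [tvDist_comm ν μ] at i1
  linarith

/-- If `E[XY | m] = E[X | m] E[Y | m]` under `μ`, the defect of this factorization under `ν` is
controlled in `L²` by the total variation distance. -/
lemma integral_sq_condExp_defect_le {Ω : Type*} {m m0 : MeasurableSpace Ω} (hm : m ≤ m0)
    (μ : Measure Ω) {ν : Measure Ω} [IsProbabilityMeasure μ] [IsProbabilityMeasure ν]
    {X Y f g h : Ω → ℝ}
    (hX : Measurable X) (hX01 : ∀ x, X x ∈ Set.Icc (0 : ℝ) 1)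
    (hY : Measurable Y) (hY01 : ∀ x, Y x ∈ Set.Icc (0 : ℝ) 1)
    (hf : IsUnitCondExp m ν X f) (hg : IsUnitCondExp m ν Y g) (hh : IsUnitCondExp m ν (X * Y) h)
    (hμ : μ[X * Y | m] =ᵐ[μ] μ[X | m] * μ[Y | m]) :
    ∫ x, (h x - f x * g x) ^ 2 ∂ν ≤ 56 * (tvDist μ ν).toReal := by
  have hXY : Measurable (X * Y) := hX.mul hY
  have hXY01 : ∀ x, (X * Y) x ∈ Set.Icc (0 : ℝ) 1 := fun x =>
    unitInterval.mul_mem (hX01 x) (hY01 x)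
  obtain ⟨f', hf'⟩ := exists_isUnitCondExp hm μ hX hX01
  obtain ⟨g', hg'⟩ := exists_isUnitCondExp hm μ hY hY01
  obtain ⟨h', hh'⟩ := exists_isUnitCondExp hm μ hXY hXY01
  have bf := hf'.integral_sq_sub_le hm hf hX hX01
  have bg := hg'.integral_sq_sub_le hm hg hY hY01
  have bh := hh'.integral_sq_sub_le hm hh hXY hXY01
  have sq_le : ∀ {a b : ℝ}, a ∈ Set.Icc (0 : ℝ) 1 → b ∈ Set.Icc (0 : ℝ) 1 →
      |(a - b) ^ 2| ≤ 1 := fun ha hb => by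
    rw [abs_pow]
    exact pow_le_one₀ (abs_nonneg _)
      (abs_le.2 ⟨by linarith [ha.1, hb.2], by linarith [ha.2, hb.1]⟩)
  have mf := hf.measurable.mono hm le_rfl
  have mg := hg.measurable.mono hm le_rfl
  have mh := hh.measurable.mono hm le_rfl
  have mf' := hf'.measurable.mono hm le_rfl
  have mg' := hg'.measurable.mono hm le_rfl
  have mh' := hh'.measurable.mono hm le_rfl
  have md : Measurable fun x => (h' x - f' x * g' x) ^ 2 := (mh'.sub (mf'.mul mg')).pow_const 2
  have bd : ∀ x, |(h' x - f' x * g' x) ^ 2| ≤ 1 := fun x =>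
    sq_le (hh'.mem_Icc x) (unitInterval.mul_mem (hf'.mem_Icc x) (hg'.mem_Icc x))
  have b0 := integral_le_add_tvDist ν μ md bd
  have hzero : ∫ x, (h' x - f' x * g' x) ^ 2 ∂μ = 0 := by
    refine integral_eq_zero_of_ae ?_
    filter_upwards [hμ, hf'.ae_eq, hg'.ae_eq, hh'.ae_eq] with x e e1 e2 e3
    simp [e1, e2, e3, e]
  rw [hzero, tvDist_comm ν μ] at b0
  have If : Integrable (fun x => (f' x - f x) ^ 2) ν :=
    integrable_of_abs_le_one ν ((mf'.sub mf).pow_const 2) fun x => sq_le (hf'.mem_Icc x) (hf.mem_Icc x)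
  have Ig : Integrable (fun x => (g' x - g x) ^ 2) ν :=
    integrable_of_abs_le_one ν ((mg'.sub mg).pow_const 2) fun x => sq_le (hg'.mem_Icc x) (hg.mem_Icc x)
  have Ih : Integrable (fun x => (h' x - h x) ^ 2) ν :=
    integrable_of_abs_le_one ν ((mh'.sub mh).pow_const 2) fun x => sq_le (hh'.mem_Icc x) (hh.mem_Icc x)
  have Id := integrable_of_abs_le_one ν md bd
  have key : ∫ x, (h x - f x * g x) ^ 2 ∂ν ≤ ∫ x, 4 * ((h' x - h x) ^ 2 +
      (h' x - f' x * g' x) ^ 2 + (f' x - f x) ^ 2 + (g' x - g x) ^ 2) ∂ν := by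
    refine integral_mono (integrable_of_abs_le_one ν ((mh.sub (mf.mul mg)).pow_const 2)
      fun x => sq_le (hh.mem_Icc x) (unitInterval.mul_mem (hf.mem_Icc x) (hg.mem_Icc x)))
      ((((Ih.add Id).add If).add Ig).const_mul 4) fun x => ?_
    have p : ((f' x - f x) * g' x) ^ 2 ≤ (f' x - f x) ^ 2 := by
      rw [mul_pow]
      exact mul_le_of_le_one_right (sq_nonneg _)
        (pow_le_one₀ (hg'.mem_Icc x).1 (hg'.mem_Icc x).2)
    have q : (f x * (g' x - g x)) ^ 2 ≤ (g' x - g x) ^ 2 := by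
      rw [mul_pow]
      exact mul_le_of_le_one_left (sq_nonneg _)
        (pow_le_one₀ (hf.mem_Icc x).1 (hf.mem_Icc x).2)
    have four_sq : ∀ a b c d : ℝ, (-a + b + c + d) ^ 2 ≤ 4 * (a ^ 2 + b ^ 2 + c ^ 2 + d ^ 2) :=
      fun a b c d => by
        nlinarith [sq_nonneg (a + b), sq_nonneg (a + c), sq_nonneg (a + d), sq_nonneg (b - c),
          sq_nonneg (b - d), sq_nonneg (c - d)]
    have r := four_sq (h' x - h x) (h' x - f' x * g' x) ((f' x - f x) * g' x)
      (f x * (g' x - g x))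
    have e : h x - f x * g x = -(h' x - h x) + (h' x - f' x * g' x) + (f' x - f x) * g' x +
      f x * (g' x - g x) := by ring
    simp only [e]
    linarith
  rw [integral_const_mul, integral_add (by exact (Ih.add Id).add If) Ig,
    integral_add (by exact Ih.add Id) If, integral_add Ih Id] at key
  linarith

lemma measurable_evtInd {Ω α : Type*} [MeasurableSpace Ω] [MeasurableSpace α] {S : Ω → α}
    (hS : Measurable S) {A : Set α} (hA : MeasurableSet A) : Measurable (evtInd S A) :=
  measurable_const.indicator (hS hA)

lemma evtInd_mem_Icc {Ω α : Type*} (S : Ω → α) (A : Set α) (x : Ω) :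
    evtInd S A x ∈ Set.Icc (0 : ℝ) 1 := by
  by_cases h : x ∈ S ⁻¹' A <;> simp [evtInd, h]

/-- For measurable spaces `S`, `W`, `Z` and the coordinate projections on
`S × W × Z`, the set of probability measures under which `S ⫫_Z W` holds is closed under
convergence in total variation. -/
theorem condIndep_closed_totalVariation {S W Z : Type*}
    [MeasurableSpace S] [MeasurableSpace W] [MeasurableSpace Z]
    (πs : ℕ → Measure (S × W × Z)) (π : Measure (S × W × Z))
    (hprob : ∀ k, IsProbabilityMeasure (πs k)) (hπ : IsProbabilityMeasure π)
    (hci : ∀ k, CondIndepRV (πs k) (fun p => p.1) (fun p => p.2.1) (fun p => p.2.2))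
    (htv : Filter.Tendsto (fun k => tvDist (πs k) π) Filter.atTop (nhds 0)) :
    CondIndepRV π (fun p => p.1) (fun p => p.2.1) (fun p => p.2.2) := by
  intro A B hA hB
  have hm : MeasurableSpace.comap (fun p : S × W × Z => p.2.2) inferInstance ≤
      (inferInstance : MeasurableSpace (S × W × Z)) :=
    (measurable_snd.comp measurable_snd).comap_le
  have hX : Measurable (evtInd (fun p : S × W × Z => p.1) A) :=
    measurable_evtInd measurable_fst hA
  have hX01 := evtInd_mem_Icc (fun p : S × W × Z => p.1) A
  have hY : Measurable (evtInd (fun p : S × W × Z => p.2.1) B) :=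
    measurable_evtInd (measurable_fst.comp measurable_snd) hB
  have hY01 := evtInd_mem_Icc (fun p : S × W × Z => p.2.1) B
  obtain ⟨f, hf⟩ := exists_isUnitCondExp hm π hX hX01
  obtain ⟨g, hg⟩ := exists_isUnitCondExp hm π hY hY01
  obtain ⟨h, hh⟩ := exists_isUnitCondExp hm π (hX.mul hY)
    fun x => unitInterval.mul_mem (hX01 x) (hY01 x)
  have hle : ∫ x, (h x - f x * g x) ^ 2 ∂π ≤ 0 := by
    have hlim : Filter.Tendsto (fun k => 56 * (tvDist (πs k) π).toReal) Filter.atTop (nhds 0) := by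
      simpa using ((ENNReal.tendsto_toReal ENNReal.zero_ne_top).comp htv).const_mul 56
    exact ge_of_tendsto' hlim fun k =>
      integral_sq_condExp_defect_le hm (πs k) hX hX01 hY hY01 hf hg hh (hci k A B hA hB)
  have hint : Integrable (fun x => (h x - f x * g x) ^ 2) π := by
    refine integrable_of_abs_le_one π (((hh.measurable.mono hm le_rfl).sub
      ((hf.measurable.mono hm le_rfl).mul (hg.measurable.mono hm le_rfl))).pow_const 2)
      fun x => ?_
    have h1 := unitInterval.mul_mem (hf.mem_Icc x) (hg.mem_Icc x)
    have h2 := hh.mem_Icc x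
    rw [abs_pow]
    exact pow_le_one₀ (abs_nonneg _)
      (abs_le.2 ⟨by linarith [h1.2, h2.1], by linarith [h1.1, h2.2]⟩)
  have hzero := (integral_eq_zero_iff_of_nonneg (fun x => sq_nonneg _) hint).1
    (le_antisymm hle (integral_nonneg fun x => sq_nonneg _))
  filter_upwards [hzero, hf.ae_eq, hg.ae_eq, hh.ae_eq] with x hx ef eg eh
  rw [Pi.mul_apply, ← ef, ← eg]
  exact eh.symm.trans (sub_eq_zero.1 (pow_eq_zero_iff two_ne_zero |>.1 hx))
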